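/- Let a ∈ (−1, 1/3) with a ≠ 0. The function z(θ) = a·ζ(θ)/((2cos θ + ζ(θ))(1 + 2ζ(θ)cos θ)), where ζ(θ) = ((2a − 1)cos θ + √((1 − 4a)cos²θ + a)) / (1 − 4a·cos²θ), is strictly increasing on the interval θ ∈ (2π/3, π) (after removing the removable discontinuity at θ = arccos(−1/(2√a)) when 1/4 < a ≤ 1/3). -/

import Mathlib

/-- `ζ(θ)` from the paper. -/
noncomputable def zetaFn (a θ : ℝ) : ℝ :=
  ((2 * a - 1) * Real.cos θ + Real.sqrt ((1 - 4 * a) * Real.cos θ ^ 2 + a)) /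
    (1 - 4 * a * Real.cos θ ^ 2)

noncomputable def tFn (a x : ℝ) : ℝ :=
  2 * x * (x + Real.sqrt ((1 - 4 * a) * x ^ 2 + a)) / (4 * x ^ 2 - 1)

lemma disc_pos (a x : ℝ) (ha : a < 1 / 3) (h1 : 1 / 2 < x) (h2 : x < 1) :
    0 < (1 - 4 * a) * x ^ 2 + a := by
  have h3 : 0 < 4 * x ^ 2 - 1 := by nlinarith
  nlinarith [mul_pos (sub_pos.2 ha) h3]

lemma tFn_facts (a x : ℝ) (ha : a < 1 / 3) (h1 : 1 / 2 < x) (h2 : x < 1) :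
    2 / 3 < tFn a x ∧ 2 * a < tFn a x ∧
      4 * x ^ 2 * (tFn a x ^ 2 - tFn a x + a) = tFn a x ^ 2 := by
  have h3 : 0 < 4 * x ^ 2 - 1 := by nlinarith
  have hD := disc_pos a x ha h1 h2
  have hs := Real.sqrt_pos.2 hD
  have hs2 := Real.sq_sqrt hD.le
  unfold tFn
  set s := Real.sqrt ((1 - 4 * a) * x ^ 2 + a)
  have hxs : 0 < x * s := by positivity
  refine ⟨?_, ?_, ?_⟩
  · rw [lt_div_iff₀ h3]; nlinarith
  · rw [lt_div_iff₀ h3]; nlinarith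
  · have ha' : a * (4 * x ^ 2 - 1) = x ^ 2 - s ^ 2 := by rw [hs2]; ring
    have ha'' : a = (x ^ 2 - s ^ 2) / (4 * x ^ 2 - 1) := by
      rw [eq_div_iff h3.ne']; exact ha'
    clear_value s
    rw [ha'']
    have := h3.ne'
    field_simp
    ring

lemma tFn_anti (a x y : ℝ) (ha : a < 1 / 3) (h1 : 1 / 2 < x) (hxy : x < y) (h2 : y < 1) :
    tFn a y < tFn a x := by
  obtain ⟨p1, p2, p3⟩ := tFn_facts a x ha h1 (hxy.trans h2)
  obtain ⟨q1, q2, q3⟩ := tFn_facts a y ha (h1.trans hxy) h2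
  generalize tFn a x = t at *
  generalize tFn a y = u at *
  by_contra! hc
  have e1 : 0 < t ^ 2 - t + a := by
    have : 0 < 4 * x ^ 2 * (t ^ 2 - t + a) := by rw [p3]; positivity
    exact pos_of_mul_pos_right this (by positivity)
  have e2 : 0 < u ^ 2 - u + a := by
    have : 0 < 4 * y ^ 2 * (u ^ 2 - u + a) := by rw [q3]; positivity
    exact pos_of_mul_pos_right this (by positivity)
  have hsq : 4 * x ^ 2 < 4 * y ^ 2 := by nlinarith
  have k : t ^ 2 * (u ^ 2 - u + a) < u ^ 2 * (t ^ 2 - t + a) := by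
    rw [← p3, ← q3]
    nlinarith [mul_pos (sub_pos.2 hsq) (mul_pos e1 e2)]
  have k2 : 0 < (t - 2 * a) * u + (u - 2 * a) * t := by
    have := mul_pos (sub_pos.2 p2) (show 0 < u by linarith)
    have := mul_pos (sub_pos.2 q2) (show 0 < t by linarith)
    linarith
  nlinarith [mul_nonneg (sub_nonneg.2 hc) k2.le]

lemma f_anti (a t u : ℝ) (ha : a < 1 / 3) (hu : 2 / 3 < u) (hut : u < t)
    (h : 0 < 3 * u ^ 2 - 4 * u + 4 * a) :
    (1 - t) * (t ^ 2 - t + a) < (1 - u) * (u ^ 2 - u + a) := by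
  have hB : 0 < t ^ 2 + t * u + u ^ 2 - 2 * (t + u) + 1 + a := by
    nlinarith [mul_nonneg (sub_nonneg.2 hut.le) (show 0 ≤ t + 2 * u - 2 by linarith)]
  nlinarith [mul_pos (sub_pos.2 hut) hB]

lemma zeta_eq (a θ x : ℝ) (ha : a < 1 / 3) (ha0 : a ≠ 0) (h1 : 1 / 2 < x) (h2 : x < 1)
    (hx : Real.cos θ = -x) (hq : 1 - 4 * a * Real.cos θ ^ 2 ≠ 0) :
    (1 - tFn a x) * (tFn a x ^ 2 - tFn a x + a) = a * zetaFn a θ /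
          ((2 * Real.cos θ + zetaFn a θ) * (1 + 2 * zetaFn a θ * Real.cos θ)) := by
  obtain ⟨p1, p2, p3⟩ := tFn_facts a x ha h1 h2
  have hx0 : x ≠ 0 := by linarith
  have ht0 : tFn a x ≠ 0 := by linarith
  rw [hx] at hq
  have ht1 : tFn a x - 1 ≠ 0 := by
    intro h
    have h' : tFn a x = 1 := by linarith
    rw [h'] at p3
    apply hq; linarith
  have hz : zetaFn a θ = tFn a x / (2 * x * (tFn a x - 1)) := by
    unfold zetaFn
    rw [hx, div_eq_div_iff hq (by positivity), neg_sq]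
    have h3 : 0 < 4 * x ^ 2 - 1 := by nlinarith
    have hs2 := Real.sq_sqrt (disc_pos a x ha h1 h2).le
    have ht : tFn a x * (4 * x ^ 2 - 1) =
      2 * x * (x + Real.sqrt ((1 - 4 * a) * x ^ 2 + a)) := by
      unfold tFn; exact div_mul_cancel₀ _ h3.ne'
    generalize Real.sqrt ((1 - 4 * a) * x ^ 2 + a) = s at *
    generalize tFn a x = t at *
    apply mul_right_cancel₀ h3.ne'
    linear_combination (2 * x * ((1 - 2 * a) * x + s) - (1 - 4 * a * x ^ 2)) * ht
      + 4 * x ^ 2 * hs2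
  rw [hz, hx]
  generalize tFn a x = t at *
  have e1 : 2 * -x + t / (2 * x * (t - 1)) = 2 * x * a / (t * (t - 1)) := by
    field_simp
    linear_combination -p3
  have e2 : 1 + 2 * (t / (2 * x * (t - 1))) * -x = -1 / (t - 1) := by
    field_simp
    ring
  rw [e1, e2]
  have e3 : t ^ 2 - t + a = t ^ 2 / (4 * x ^ 2) := by
    rw [eq_div_iff (by positivity)]; linarith
  rw [e3]
  field_simp
  ring

/-- For `a ∈ (-1, 1/3)`, `a ≠ 0`, the function
`z(θ) = aζ(θ)/((2cos θ + ζ(θ))(1 + 2ζ(θ)cos θ))`, with its removable discontinuity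
removed, is strictly increasing on `(2π/3, π)`. -/
theorem stmt_11 (a : ℝ) (ha : a ∈ Set.Ioo (-1 : ℝ) (1 / 3)) (ha0 : a ≠ 0) :
    ∃ Z : ℝ → ℝ, ContinuousOn Z (Set.Ioo (2 * Real.pi / 3) Real.pi) ∧
      (∀ θ ∈ Set.Ioo (2 * Real.pi / 3) Real.pi, 1 - 4 * a * Real.cos θ ^ 2 ≠ 0 →
        Z θ = a * zetaFn a θ /
          ((2 * Real.cos θ + zetaFn a θ) * (1 + 2 * zetaFn a θ * Real.cos θ))) ∧
      StrictMonoOn Z (Set.Ioo (2 * Real.pi / 3) Real.pi) := by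
  have ha3 := ha.2
  have hc : ∀ θ ∈ Set.Ioo (2 * Real.pi / 3) Real.pi,
      1 / 2 < -Real.cos θ ∧ -Real.cos θ < 1 := by
    intro θ hθ
    have hpi := Real.pi_pos
    have e : Real.cos (2 * Real.pi / 3) = -(1 / 2) := by
      rw [show 2 * Real.pi / 3 = Real.pi - Real.pi / 3 by ring, Real.cos_pi_sub,
        Real.cos_pi_div_three]
    have i1 := Real.cos_lt_cos_of_nonneg_of_le_pi (by positivity) hθ.2.le hθ.1
    have i2 := Real.cos_lt_cos_of_nonneg_of_le_pi (by linarith [hθ.1]) le_rfl hθ.2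
    rw [e] at i1
    rw [Real.cos_pi] at i2
    constructor <;> linarith
  have hcont : ContinuousOn (fun θ => tFn a (-Real.cos θ))
      (Set.Ioo (2 * Real.pi / 3) Real.pi) := by
    unfold tFn
    apply ContinuousOn.div
    · fun_prop
    · fun_prop
    · intro θ hθ
      have := (hc θ hθ).1
      nlinarith
  refine ⟨fun θ => (1 - tFn a (-Real.cos θ)) *
    (tFn a (-Real.cos θ) ^ 2 - tFn a (-Real.cos θ) + a), ?_, ?_, ?_⟩
  · fun_prop
  · intro θ hθ hq
    exact zeta_eq a θ _ ha3 ha0 (hc θ hθ).1 (hc θ hθ).2 (by ring) hq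
  · intro θ hθ φ hφ hlt
    have hpi := Real.pi_pos
    have hcos := Real.cos_lt_cos_of_nonneg_of_le_pi (by linarith [hθ.1]) hφ.2.le hlt
    have hanti := tFn_anti a (-Real.cos θ) (-Real.cos φ) ha3 (hc θ hθ).1 (by linarith) (hc φ hφ).2
    obtain ⟨q1, q2, q3⟩ := tFn_facts a (-Real.cos φ) ha3 (hc φ hφ).1 (hc φ hφ).2
    have hy := hc φ hφ
    refine f_anti a _ _ ha3 q1 hanti ?_
    generalize tFn a (-Real.cos φ) = u at *
    generalize -Real.cos φ = y at *
    have e2 : 0 < u ^ 2 - u + a := by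
      have : 0 < 4 * y ^ 2 * (u ^ 2 - u + a) := by rw [q3]; positivity
      exact pos_of_mul_pos_right this (by positivity)
    have : 0 < 1 - y ^ 2 := by nlinarith
    nlinarith [mul_pos this e2]
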